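/- arXiv:1211.0865 — 10 statements merged into one kernel-verified Lean document; each statement's English description precedes it below -/
import Mathlib

section
/- Let →a and →b be binary relations on a set X and let S ⊆ X. Assume: (1) no element of S has an →a-successor; (2) →a is confluent; (3) for every m such that m →a* s for some s ∈ S, and for all m', m'' with m →a m' and m →b m'', there exists m''' such that m'' →a* m''' and either m' →b m''' or m' →a* m'''; (4) every →a-normal form is also a →b-normal form. Then for every T ∈ S and all m, m' with m →a* T and m →b m', we have m' →a* T. -/
open Relation

theorem type_preservation_abstract {X : Type*} (ra rb : X → X → Prop) (S : Set X)
    (h1 : ∀ s ∈ S, ∀ y, ¬ ra s y)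
    (h2 : ∀ x y z, ReflTransGen ra x y → ReflTransGen ra x z →
      ∃ w, ReflTransGen ra y w ∧ ReflTransGen ra z w)
    (h3 : ∀ m, (∃ s ∈ S, ReflTransGen ra m s) →
      ∀ m' m'', ra m m' → rb m m'' →
        ∃ m''', ReflTransGen ra m'' m''' ∧ (rb m' m''' ∨ ReflTransGen ra m' m'''))
    (h4 : ∀ x, (∀ y, ¬ ra x y) → ∀ y, ¬ rb x y) :
    ∀ T ∈ S, ∀ m m', ReflTransGen ra m T → rb m m' → ReflTransGen ra m' T := by
  intro T hT m m' hm
  induction hm using ReflTransGen.head_induction_on generalizing m' with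
  | refl => exact fun hb => (h4 T (h1 T hT) m' hb).elim
  | head hstep hrest ih =>
    intro hb
    obtain ⟨n, hn, hbn | han⟩ := h3 _ ⟨T, hT, .head hstep hrest⟩ _ _ hstep hb
    · exact hn.trans (ih n hbn)
    · obtain ⟨w, hTw, hnw⟩ := h2 _ _ _ hrest han
      obtain rfl : T = w := by
        rcases hTw.cases_head with h | ⟨y, hy, _⟩
        · exact h
        · exact (h1 T hT y hy).elim
      exact hn.trans hnw
end

section
/- Let →a and →b be binary relations on a set X. Assume: (1) →a is confluent; (2) for all t, t', v with t →a t' and t →b v there exists w with v →a* w and either t' →b w or t' →a* w. Then for all t, u, v with t →a* u and t →b v there exists w with v →a* w and either u →b w or u →a* w. -/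
open Relation

theorem extend_commutation {X : Type*} (ra rb : X → X → Prop)
    (h1 : ∀ x y z, ReflTransGen ra x y → ReflTransGen ra x z →
      ∃ w, ReflTransGen ra y w ∧ ReflTransGen ra z w)
    (h2 : ∀ t t' v, ra t t' → rb t v →
      ∃ w, ReflTransGen ra v w ∧ (rb t' w ∨ ReflTransGen ra t' w)) :
    ∀ t u v, ReflTransGen ra t u → rb t v →
      ∃ w, ReflTransGen ra v w ∧ (rb u w ∨ ReflTransGen ra u w) := by
  intro t u v htu htv
  induction htu with
  | refl => exact ⟨v, .refl, .inl htv⟩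
  | tail _ hbc ih =>
    obtain ⟨w, hvw, hbw | hbw⟩ := ih
    · obtain ⟨w', hww', h⟩ := h2 _ _ _ hbc hbw
      exact ⟨w', hvw.trans hww', h⟩
    · obtain ⟨w', hcw', hww'⟩ := h1 _ _ _ (.single hbc) hbw
      exact ⟨w', hvw.trans hww', .inr hcw'⟩
end

section
/- Let →a and →b be binary relations on a set X. Assume: (1) →a is terminating (there is no infinite chain a₁ →a a₂ →a ⋯); (2) →a is confluent; (3) for all t, t', v with t →a t' and t →b v there exists w with v →a* w and either t' →b w or t' →a* w; (4) every →a-normal form is also a →b-normal form. Then the union →a ∪ →b is confluent. -/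
open Relation

/-- The endpoints of an `rb`-step have a common `ra`-reduct. -/
theorem join_of_step {X : Type*} {ra rb : X → X → Prop}
    (hwf : WellFounded (Function.swap ra))
    (h3 : ∀ t t' v, ra t t' → rb t v →
      ∃ w, ReflTransGen ra v w ∧ (rb t' w ∨ ReflTransGen ra t' w))
    (h4 : ∀ x, (∀ y, ¬ ra x y) → ∀ y, ¬ rb x y) (t : X) :
    ∀ v, rb t v → Join (ReflTransGen ra) t v := by
  induction t using hwf.induction with
  | _ t ih =>
    intro v hv
    obtain ⟨t', ht'⟩ : ∃ t', ra t t' := by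
      by_contra! hnf
      exact h4 t hnf v hv
    obtain ⟨w, hvw, hw | hw⟩ := h3 t t' v ht' hv
    · obtain ⟨z, hz, hwz⟩ := ih t' ht' w hw
      exact ⟨z, hz.head ht', hvw.trans hwz⟩
    · exact ⟨w, hw.head ht', hvw⟩

theorem union_confluent {X : Type*} (ra rb : X → X → Prop)
    (h1 : ¬ ∃ f : ℕ → X, ∀ n, ra (f n) (f (n + 1)))
    (h2 : ∀ x y z, ReflTransGen ra x y → ReflTransGen ra x z →
      ∃ w, ReflTransGen ra y w ∧ ReflTransGen ra z w)
    (h3 : ∀ t t' v, ra t t' → rb t v →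
      ∃ w, ReflTransGen ra v w ∧ (rb t' w ∨ ReflTransGen ra t' w))
    (h4 : ∀ x, (∀ y, ¬ ra x y) → ∀ y, ¬ rb x y) :
    ∀ t u v, ReflTransGen (fun x y => ra x y ∨ rb x y) t u →
      ReflTransGen (fun x y => ra x y ∨ rb x y) t v →
      ∃ w, ReflTransGen (fun x y => ra x y ∨ rb x y) u w ∧
        ReflTransGen (fun x y => ra x y ∨ rb x y) v w := by
  have hwf : WellFounded (Function.swap ra) :=
    wellFounded_iff_isEmpty_descending_chain.2 ⟨fun f => h1 ⟨f.1, f.2⟩⟩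
  have join_trans {x y z : X} (hxy : Join (ReflTransGen ra) x y)
      (hyz : Join (ReflTransGen ra) y z) : Join (ReflTransGen ra) x z := by
    obtain ⟨p, hxp, hyp⟩ := hxy
    obtain ⟨q, hyq, hzq⟩ := hyz
    obtain ⟨w, hpw, hqw⟩ := h2 y p q hyp hyq
    exact ⟨w, hxp.trans hpw, hzq.trans hqw⟩
  have join_of_reduces {x y : X} (h : ReflTransGen (fun x y => ra x y ∨ rb x y) x y) :
      Join (ReflTransGen ra) x y := by
    induction h with
    | refl => exact ⟨x, .refl, .refl⟩
    | @tail y z _ hyz ih =>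
      refine join_trans ih (hyz.elim (fun h => ⟨z, .single h, .refl⟩) ?_)
      exact join_of_step hwf h3 h4 y z
  intro t u v hu hv
  obtain ⟨p, htp, hup⟩ := join_of_reduces hu
  obtain ⟨q, htq, hvq⟩ := join_of_reduces hv
  obtain ⟨w, hpw, hqw⟩ := h2 t p q htp htq
  exact ⟨w, ReflTransGen.mono (fun _ _ => Or.inl) _ _ (hup.trans hpw),
    ReflTransGen.mono (fun _ _ => Or.inl) _ _ (hvq.trans hqw)⟩
end

section
/- The abstract reduction relation →a on mixed terms is terminating: there is no infinite chain m₁ →a m₂ →a ⋯. -/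
/-- Simple types: `T ::= A | T₁ ⇒ T₂`. -/
inductive MTy : Type
  | base : MTy
  | arrow : MTy → MTy → MTy
  deriving DecidableEq

/-- Mixed terms (de Bruijn indices for variables):
`m ::= x | λx:T.m | m m' | a | f | A | T ⇒ m`. -/
inductive MTm : Type
  | var : ℕ → MTm
  | lam : MTy → MTm → MTm
  | app : MTm → MTm → MTm
  | ca : MTm            -- the term constant `a`
  | cf : MTm            -- the term constant `f`
  | tyA : MTm           -- the base type `A` as a mixed term
  | arr : MTy → MTm → MTm  -- `T ⇒ m`
  deriving DecidableEq

namespace MTm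

/-- The embedding of types into mixed terms. -/
def ofTy : MTy → MTm
  | .base => tyA
  | .arrow T1 T2 => arr T1 (ofTy T2)

/-- de Bruijn shifting of indices `≥ c` by `d`. -/
def shift (d c : ℕ) : MTm → MTm
  | var k => if k < c then var k else var (k + d)
  | lam T m => lam T (shift d (c + 1) m)
  | app m1 m2 => app (shift d c m1) (shift d c m2)
  | ca => ca
  | cf => cf
  | tyA => tyA
  | arr T m => arr T (shift d c m)

/-- Capture-avoiding substitution `[s / j] m` (de Bruijn). -/
def subst (j : ℕ) (s : MTm) : MTm → MTm
  | var k => if k = j then s else if j < k then var (k - 1) else var k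
  | lam T m => lam T (subst (j + 1) (shift 1 0 s) m)
  | app m1 m2 => app (subst j s m1) (subst j s m2)
  | ca => ca
  | cf => cf
  | tyA => tyA
  | arr T m => arr T (subst j s m)

/-- Mixed values: `u ::= λx:T.m | T ⇒ m | A | a | f`. -/
inductive IsValue : MTm → Prop
  | lam (T m) : IsValue (lam T m)
  | arr (T m) : IsValue (arr T m)
  | tyA : IsValue tyA
  | ca : IsValue ca
  | cf : IsValue cf

/-- Abstract reduction `→a`, closed under arbitrary contexts. -/
inductive StepA : MTm → MTm → Prop
  | beta (T m) : StepA (app (arr T m) (ofTy T)) m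
  | lamAbs (T m) : StepA (lam T m) (arr T (subst 0 (ofTy T) m))
  | cfAbs : StepA cf (arr .base tyA)
  | caAbs : StepA ca tyA
  | lamC {m m'} (T) : StepA m m' → StepA (lam T m) (lam T m')
  | appL {m1 m1'} (m2) : StepA m1 m1' → StepA (app m1 m2) (app m1' m2)
  | appR {m2 m2'} (m1) : StepA m2 m2' → StepA (app m1 m2) (app m1 m2')
  | arrC {m m'} (T) : StepA m m' → StepA (arr T m) (arr T m')

/-- Concrete full β-reduction `→b`, closed under arbitrary contexts. -/
inductive StepB : MTm → MTm → Prop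
  | beta (T m m') : StepB (app (lam T m) m') (subst 0 m' m)
  | fa : StepB (app cf ca) ca
  | lamC {m m'} (T) : StepB m m' → StepB (lam T m) (lam T m')
  | appL {m1 m1'} (m2) : StepB m1 m1' → StepB (app m1 m2) (app m1' m2)
  | appR {m2 m2'} (m1) : StepB m2 m2' → StepB (app m1 m2) (app m1 m2')
  | arrC {m m'} (T) : StepB m m' → StepB (arr T m) (arr T m')

/-- Call-by-value reduction `→c`: redexes contracted inside
call-by-value evaluation contexts `E_c ::= * | E_c m | u E_c`. -/
inductive StepC : MTm → MTm → Prop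
  | beta {u} (T m) : IsValue u → StepC (app (lam T m) u) (subst 0 u m)
  | fa : StepC (app cf ca) ca
  | appL {m1 m1'} (m2) : StepC m1 m1' → StepC (app m1 m2) (app m1' m2)
  | appR {u m2 m2'} : IsValue u → StepC m2 m2' → StepC (app u m2) (app u m2')

/-- Standard terms: mixed terms containing no type subterm. -/
inductive IsStandard : MTm → Prop
  | var (x) : IsStandard (var x)
  | lam (T) {t} : IsStandard t → IsStandard (lam T t)
  | app {t1 t2} : IsStandard t1 → IsStandard t2 → IsStandard (app t1 t2)
  | ca : IsStandard ca
  | cf : IsStandard cf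

/-- Standard values: `v ::= λx:T.t | a | f` with `t` standard. -/
inductive IsStdValue : MTm → Prop
  | lam (T) {t} : IsStandard t → IsStdValue (lam T t)
  | ca : IsStdValue ca
  | cf : IsStdValue cf

/-- All free de Bruijn indices are `< n`. -/
def ClosedUnder : ℕ → MTm → Prop
  | n, var k => k < n
  | n, lam _ m => ClosedUnder (n + 1) m
  | n, app m1 m2 => ClosedUnder n m1 ∧ ClosedUnder n m2
  | _, ca => True
  | _, cf => True
  | _, tyA => True
  | n, arr _ m => ClosedUnder n m

/-- Quasi-stuck terms. -/
inductive QuasiStuck : MTm → Prop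
  | val {u} : IsValue u → QuasiStuck u
  | app_ca {s} : QuasiStuck s → QuasiStuck (app ca s)
  | app_tyA {s} : QuasiStuck s → QuasiStuck (app tyA s)
  | app_cf {s} : QuasiStuck s → s ≠ ca → s ≠ tyA → QuasiStuck (app cf s)
  | app_AA {s} : QuasiStuck s → s ≠ ca → s ≠ tyA →
      QuasiStuck (app (arr .base tyA) s)
  | app_lam {s} (T m) : QuasiStuck s → ¬ IsValue s → QuasiStuck (app (lam T m) s)
  | app_arr {s} (T m) : QuasiStuck s → ¬ IsValue s → QuasiStuck (app (arr T m) s)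
  | app_app {s s'} : QuasiStuck s → QuasiStuck s' → ¬ IsValue s →
      QuasiStuck (app s s')

end MTm

open Relation MTm

namespace MTm

/-- The number of abstractions, applications and term constants in a mixed term. -/
def weight : MTm → ℕ
  | var _ => 0
  | lam _ m => weight m + 1
  | app m1 m2 => weight m1 + weight m2 + 1
  | ca => 1
  | cf => 1
  | tyA => 0
  | arr _ m => weight m

theorem weight_ofTy (T : MTy) : (ofTy T).weight = 0 := by
  induction T with
  | base => rfl
  | arrow _ _ _ ih => exact ih

theorem weight_shift (d c : ℕ) (m : MTm) : (shift d c m).weight = m.weight := by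
  induction m generalizing c with
  | var k => rw [shift]; split <;> rfl
  | _ => simp_all [shift, weight]

/-- Substituting a weightless term, such as a type, preserves the weight. -/
theorem weight_subst {s : MTm} (hs : s.weight = 0) (j : ℕ) (m : MTm) :
    (subst j s m).weight = m.weight := by
  induction m generalizing j s with
  | var k => rw [subst]; split_ifs <;> simp [weight, hs]
  | lam T m ih => simp [subst, weight, ih ((weight_shift 1 0 s).trans hs)]
  | _ => simp_all [subst, weight]

theorem StepA.weight_lt {m m' : MTm} (h : StepA m m') : m'.weight < m.weight := by
  induction h with
  | lamAbs T m => simp [weight, weight_subst (weight_ofTy T)]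
  | _ => simp only [weight] at *; omega

end MTm

/-- Termination of abstract reduction: there is no infinite `→a`-chain. -/
theorem stepA_terminating : ¬ ∃ f : ℕ → MTm, ∀ n, StepA (f n) (f (n + 1)) := by
  rintro ⟨f, hf⟩
  exact not_strictAnti_of_wellFoundedLT (fun n => (f n).weight)
    (strictAnti_nat_of_succ_lt fun n => (hf n).weight_lt)
end

section
/- The abstract reduction relation →a on mixed terms has the diamond property (if m₁ ←a m →a m₂ then there exists m₃ with m₁ →a⁼ m₃ ←a⁼ m₂, where →a⁼ is the reflexive closure), and hence →a is confluent. -/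
open Relation MTm

namespace MTm

theorem shift_ofTy (d c : ℕ) (T : MTy) : shift d c (ofTy T) = ofTy T := by
  induction T with
  | base => rfl
  | arrow T1 T2 _ ih => simp [ofTy, shift, ih]

theorem subst_ofTy (j : ℕ) (s : MTm) (T : MTy) : subst j s (ofTy T) = ofTy T := by
  induction T with
  | base => rfl
  | arrow T1 T2 _ ih => simp [ofTy, subst, ih]

/-- Substitutions of (closed) types for distinct variables commute. -/
theorem subst_ofTy_comm {i j : ℕ} (hij : i ≤ j) (S T : MTy) (m : MTm) :
    subst j (ofTy T) (subst i (ofTy S) m) = subst i (ofTy S) (subst (j + 1) (ofTy T) m) := by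
  induction m generalizing i j with
  | var k =>
    rcases lt_trichotomy k i with h | h | h
    · simp [subst, show k ≠ i by omega, show ¬ i < k by omega, show k ≠ j by omega,
        show ¬ j < k by omega, show k ≠ j + 1 by omega, show ¬ j + 1 < k by omega]
    · subst h
      simp [subst, subst_ofTy, show k ≠ j + 1 by omega, show ¬ j + 1 < k by omega]
    · rcases lt_trichotomy k (j + 1) with h' | h' | h'
      · simp [subst, show k ≠ i by omega, h, show k - 1 ≠ j by omega,
          show ¬ j < k - 1 by omega, show k ≠ j + 1 by omega, show ¬ j + 1 < k by omega]
      · subst h'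
        simp [subst, subst_ofTy, show j + 1 ≠ i by omega, h]
      · simp [subst, show k ≠ i by omega, h, show k - 1 ≠ j by omega,
          show j < k - 1 by omega, show k ≠ j + 1 by omega, h',
          show k - 1 ≠ i by omega, show i < k - 1 by omega]
  | lam U m ih => simp [subst, shift_ofTy, ih (Nat.succ_le_succ hij)]
  | app m1 m2 ih1 ih2 => simp [subst, ih1 hij, ih2 hij]
  | ca => rfl
  | cf => rfl
  | tyA => rfl
  | arr U m ih => simp [subst, ih hij]

theorem not_stepA_ofTy (T : MTy) (m : MTm) : ¬ StepA (ofTy T) m := by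
  induction T generalizing m with
  | base => intro h; cases h
  | arrow T1 T2 _ ih =>
    intro h
    cases h with
    | arrC _ h => exact ih _ h

theorem StepA.subst_ofTy {m m' : MTm} (h : StepA m m') (j : ℕ) (S : MTy) :
    StepA (subst j (ofTy S) m) (subst j (ofTy S) m') := by
  induction h generalizing j with
  | beta T m =>
    simp only [subst, MTm.subst_ofTy]
    exact .beta _ _
  | lamAbs T m =>
    simp only [subst, shift_ofTy, subst_ofTy_comm (Nat.zero_le j)]
    exact .lamAbs _ _
  | cfAbs => exact .cfAbs
  | caAbs => exact .caAbs
  | lamC T _ ih =>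
    simp only [subst, shift_ofTy]
    exact .lamC _ (ih _)
  | appL m2 _ ih => exact .appL _ (ih _)
  | appR m1 _ ih => exact .appR _ (ih _)
  | arrC T _ ih => exact .arrC _ (ih _)

/-- A context preserving single steps preserves joinability in at most one step. -/
theorem joinable_map {f : MTm → MTm} (hf : ∀ {x y}, StepA x y → StepA (f x) (f y))
    {m1 m2 : MTm} (h : ∃ m3, ReflGen StepA m1 m3 ∧ ReflGen StepA m2 m3) :
    ∃ m3, ReflGen StepA (f m1) m3 ∧ ReflGen StepA (f m2) m3 := by
  have lift {x y} (hxy : ReflGen StepA x y) : ReflGen StepA (f x) (f y) := by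
    cases hxy with
    | refl => exact .refl
    | single hs => exact .single (hf hs)
  obtain ⟨m3, h1, h2⟩ := h
  exact ⟨f m3, lift h1, lift h2⟩

theorem stepA_diamond {m m1 m2 : MTm} (h1 : StepA m m1) (h2 : StepA m m2) :
    ∃ m3, ReflGen StepA m1 m3 ∧ ReflGen StepA m2 m3 := by
  induction h1 generalizing m2 with
  | beta T m =>
    generalize hs : ofTy T = s at h2
    cases h2 with
    | beta => exact ⟨_, .refl, .refl⟩
    | appL _ h =>
      cases h with
      | arrC _ h => subst hs; exact ⟨_, .single h, .single (.beta _ _)⟩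
    | appR _ h => subst hs; exact (not_stepA_ofTy _ _ h).elim
  | lamAbs T m =>
    cases h2 with
    | lamAbs => exact ⟨_, .refl, .refl⟩
    | lamC _ h => exact ⟨_, .single (.arrC _ (h.subst_ofTy 0 T)), .single (.lamAbs _ _)⟩
  | cfAbs => cases h2; exact ⟨_, .refl, .refl⟩
  | caAbs => cases h2; exact ⟨_, .refl, .refl⟩
  | lamC T h ih =>
    cases h2 with
    | lamAbs => exact ⟨_, .single (.lamAbs _ _), .single (.arrC _ (h.subst_ofTy 0 T))⟩
    | lamC _ h' => exact joinable_map (.lamC T) (ih h')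
  | appL s h ih =>
    cases h2 with
    | beta =>
      cases h with
      | arrC _ h => exact ⟨_, .single (.beta _ _), .single h⟩
    | appL _ h' => exact joinable_map (f := fun x => app x s) (.appL s) (ih h')
    | appR _ h' => exact ⟨_, .single (.appR _ h'), .single (.appL _ h)⟩
  | appR s h ih =>
    cases h2 with
    | beta => exact (not_stepA_ofTy _ _ h).elim
    | appL _ h' => exact ⟨_, .single (.appL _ h'), .single (.appR _ h)⟩
    | appR _ h' => exact joinable_map (.appR s) (ih h')
  | arrC T h ih =>
    cases h2 with
    | arrC _ h' => exact joinable_map (.arrC T) (ih h')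

end MTm

/-- `→a` has the diamond property, and hence is confluent. -/
theorem stepA_diamond_and_confluent :
    (∀ m m1 m2 : MTm, StepA m m1 → StepA m m2 →
      ∃ m3, ReflGen StepA m1 m3 ∧ ReflGen StepA m2 m3) ∧
    (∀ m m1 m2 : MTm, ReflTransGen StepA m m1 → ReflTransGen StepA m m2 →
      ∃ m3, ReflTransGen StepA m1 m3 ∧ ReflTransGen StepA m2 m3) := by
  refine ⟨fun _ _ _ => stepA_diamond, fun _ _ _ h1 h2 => church_rosser ?_ h1 h2⟩
  intro _ _ _ h h'
  obtain ⟨m3, h1, h2⟩ := stepA_diamond h h'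
  exact ⟨m3, h1, h2.to_reflTransGen⟩
end

section
/- (Reduction of Quasi-Stuck Terms) If m is quasi-stuck and m →a m', then m' is also quasi-stuck. Furthermore, if m is a mixed value then so is m', and if m is not a mixed value then neither is m'. -/
open Relation MTm

theorem MTm.isValue_ofTy (T : MTy) : IsValue (ofTy T) := by
  cases T <;> constructor

theorem MTm.not_isValue_app (m₁ m₂ : MTm) : ¬ IsValue (app m₁ m₂) := nofun

theorem MTm.IsValue.stepA {u m : MTm} (hu : IsValue u) (h : StepA u m) : IsValue m := by
  cases hu <;> cases h <;> constructor

/-- A value other than `a` does not reduce to `a` or `A`. -/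
theorem MTm.IsValue.stepA_ne {u m : MTm} (hu : IsValue u) (hca : u ≠ MTm.ca) (h : StepA u m) :
    m ≠ MTm.ca ∧ m ≠ MTm.tyA := by
  cases hu <;> cases h <;> first | exact absurd rfl hca | constructor <;> nofun

theorem MTm.StepA.ne_ca_tyA {s m : MTm} (h : StepA s m) (hca : s ≠ ca)
    (hval : ¬ IsValue s → ¬ IsValue m) : m ≠ ca ∧ m ≠ tyA := by
  by_cases hs : IsValue s
  · exact hs.stepA_ne hca h
  · exact ⟨fun e => hval hs (e ▸ .ca), fun e => hval hs (e ▸ .tyA)⟩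

/-- Abstract reduction preserves quasi-stuckness and, on quasi-stuck terms, being a non-value. -/
theorem MTm.QuasiStuck.stepA {m m' : MTm} (hqs : QuasiStuck m) (h : StepA m m') :
    QuasiStuck m' ∧ (¬ IsValue m → ¬ IsValue m') := by
  induction hqs generalizing m' with
  | val hu => exact ⟨.val (hu.stepA h), fun hn => absurd hu hn⟩
  | app_ca hs ih =>
    cases h with
    | appL _ h => cases h; exact ⟨.app_tyA hs, fun _ => not_isValue_app _ _⟩
    | appR _ h => exact ⟨.app_ca (ih h).1, fun _ => not_isValue_app _ _⟩
  | app_tyA hs ih =>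
    cases h with
    | appL _ h => cases h
    | appR _ h => exact ⟨.app_tyA (ih h).1, fun _ => not_isValue_app _ _⟩
  | app_cf hs hca htyA ih =>
    cases h with
    | appL _ h => cases h; exact ⟨.app_AA hs hca htyA, fun _ => not_isValue_app _ _⟩
    | appR _ h =>
      have hne := h.ne_ca_tyA hca (ih h).2
      exact ⟨.app_cf (ih h).1 hne.1 hne.2, fun _ => not_isValue_app _ _⟩
  | app_AA hs hca htyA ih =>
    generalize hf : arr .base tyA = f at h
    cases h with
    | beta T m => cases hf; exact absurd rfl htyA
    | appL _ h => subst hf; cases h with | arrC _ h => cases h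
    | appR _ h =>
      subst hf
      have hne := h.ne_ca_tyA hca (ih h).2
      exact ⟨.app_AA (ih h).1 hne.1 hne.2, fun _ => not_isValue_app _ _⟩
  | app_lam T m hs hn ih =>
    cases h with
    | appL _ h =>
      cases h with
      | lamAbs => exact ⟨.app_arr _ _ hs hn, fun _ => not_isValue_app _ _⟩
      | lamC _ h => exact ⟨.app_lam _ _ hs hn, fun _ => not_isValue_app _ _⟩
    | appR _ h => exact ⟨.app_lam _ _ (ih h).1 ((ih h).2 hn), fun _ => not_isValue_app _ _⟩
  | app_arr T m hs hn ih =>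
    cases h with
    | beta => exact absurd (isValue_ofTy _) hn
    | appL _ h =>
      cases h with
      | arrC _ h => exact ⟨.app_arr _ _ hs hn, fun _ => not_isValue_app _ _⟩
    | appR _ h => exact ⟨.app_arr _ _ (ih h).1 ((ih h).2 hn), fun _ => not_isValue_app _ _⟩
  | app_app hs hs' hn ih ih' =>
    cases h with
    | beta => exact absurd (.arr _ _) hn
    | appL _ h => exact ⟨.app_app (ih h).1 hs' ((ih h).2 hn), fun _ => not_isValue_app _ _⟩
    | appR _ h => exact ⟨.app_app hs (ih' h).1 hn, fun _ => not_isValue_app _ _⟩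

/-- Reduction of quasi-stuck terms: quasi-stuckness and (non-)valuehood are
preserved by abstract reduction. -/
theorem quasi_stuck_preserved (m m' : MTm)
    (hqs : QuasiStuck m) (h : StepA m m') :
    QuasiStuck m' ∧ (IsValue m → IsValue m') ∧ (¬ IsValue m → ¬ IsValue m') := by
  exact ⟨(hqs.stepA h).1, fun hu => hu.stepA h, (hqs.stepA h).2⟩
end

section
/- Suppose m is a closed quasi-stuck mixed term and m →ca* T for some type T, where →ca is the union of call-by-value reduction →c and abstract reduction →a. Then m is a mixed value. -/
open Relation MTm

namespace MTm

theorem isValue_ofTy_s12 (T : MTy) : IsValue (ofTy T) := by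
  cases T
  · exact .tyA
  · exact .arr _ _

/-- The union of call-by-value reduction and abstract reduction. -/
def StepCA (x y : MTm) : Prop := StepC x y ∨ StepA x y

/-- A step from an application is a step of the function, a step of the argument, or the
contraction of a redex at the root. -/
theorem StepCA.app_cases {s t r : MTm} (h : StepCA (app s t) r) :
    (∃ s', StepCA s s' ∧ r = app s' t) ∨ (∃ t', StepCA t t' ∧ r = app s t') ∨
      (∃ T m, s = lam T m ∧ IsValue t) ∨ (s = cf ∧ t = ca) ∨
      (∃ T, s = arr T r ∧ t = ofTy T) := by
  rcases h with h | h
  · cases h with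
    | beta T m hu => exact .inr (.inr (.inl ⟨T, m, rfl, hu⟩))
    | fa => exact .inr (.inr (.inr (.inl ⟨rfl, rfl⟩)))
    | appL _ h => exact .inl ⟨_, .inl h, rfl⟩
    | appR _ h => exact .inr (.inl ⟨_, .inl h, rfl⟩)
  · cases h with
    | beta T m => exact .inr (.inr (.inr (.inr ⟨T, rfl, rfl⟩)))
    | appL _ h => exact .inl ⟨_, .inr h, rfl⟩
    | appR _ h => exact .inr (.inl ⟨_, .inr h, rfl⟩)

theorem StepCA.isValue {u r : MTm} (h : StepCA u r) (hu : IsValue u) : IsValue r := by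
  rcases h with h | h
  · cases hu <;> cases h
  · cases hu <;> cases h <;> constructor

theorem StepCA.eq_tyA_of_ca {r : MTm} (h : StepCA ca r) : r = tyA := by
  rcases h with h | h <;> cases h
  rfl

theorem StepCA.eq_arr_of_cf {r : MTm} (h : StepCA cf r) : r = arr .base tyA := by
  rcases h with h | h <;> cases h
  rfl

theorem not_stepCA_tyA {r : MTm} : ¬ StepCA tyA r := by
  rintro (h | h) <;> cases h

theorem not_stepCA_arr_base_tyA {r : MTm} : ¬ StepCA (arr .base tyA) r := by
  rintro (h | h) <;> cases h
  exact not_stepCA_tyA (.inr ‹_›)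

theorem StepCA.exists_of_arr {T : MTy} {m r : MTm} (h : StepCA (arr T m) r) :
    ∃ m', r = arr T m' := by
  rcases h with h | h <;> cases h
  exact ⟨_, rfl⟩

theorem StepCA.exists_of_lam {T : MTy} {m r : MTm} (h : StepCA (lam T m) r) :
    ∃ m', r = lam T m' ∨ r = arr T m' := by
  rcases h with h | h <;> cases h
  · exact ⟨_, .inr rfl⟩
  · exact ⟨_, .inl rfl⟩

/-- Quasi-stuck terms other than `a` and `A` cannot become `a` or `A`, and quasi-stuckness and
being a non-value are both preserved by reduction. -/
theorem QuasiStuck.stepCA {s r : MTm} (hs : QuasiStuck s) (h : StepCA s r) :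
    QuasiStuck r ∧ (¬ IsValue s → ¬ IsValue r) ∧ (s ≠ ca → s ≠ tyA → r ≠ ca ∧ r ≠ tyA) := by
  induction hs generalizing r with
  | val hu =>
    refine ⟨.val (h.isValue hu), fun hn => (hn hu).elim, fun h₁ h₂ => ?_⟩
    cases hu with
    | lam T m => obtain ⟨m', rfl | rfl⟩ := h.exists_of_lam <;> exact ⟨nofun, nofun⟩
    | arr T m => obtain ⟨m', rfl⟩ := h.exists_of_arr; exact ⟨nofun, nofun⟩
    | tyA => exact absurd rfl h₂
    | ca => exact absurd rfl h₁
    | cf => rw [h.eq_arr_of_cf]; exact ⟨nofun, nofun⟩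
  | app_ca hs ih =>
    rcases h.app_cases with ⟨s', h', rfl⟩ | ⟨t', h', rfl⟩ | ⟨_, _, ⟨⟩, _⟩ | ⟨⟨⟩, _⟩ | ⟨_, ⟨⟩, _⟩
    · cases h'.eq_tyA_of_ca
      exact ⟨.app_tyA hs, fun _ => nofun, fun _ _ => ⟨nofun, nofun⟩⟩
    · exact ⟨.app_ca (ih h').1, fun _ => nofun, fun _ _ => ⟨nofun, nofun⟩⟩
  | app_tyA hs ih =>
    rcases h.app_cases with ⟨s', h', rfl⟩ | ⟨t', h', rfl⟩ | ⟨_, _, ⟨⟩, _⟩ | ⟨⟨⟩, _⟩ | ⟨_, ⟨⟩, _⟩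
    · exact (not_stepCA_tyA h').elim
    · exact ⟨.app_tyA (ih h').1, fun _ => nofun, fun _ _ => ⟨nofun, nofun⟩⟩
  | app_cf hs h₁ h₂ ih =>
    rcases h.app_cases with ⟨s', h', rfl⟩ | ⟨t', h', rfl⟩ | ⟨_, _, ⟨⟩, _⟩ | ⟨_, h'⟩ | ⟨_, ⟨⟩, _⟩
    · cases h'.eq_arr_of_cf
      exact ⟨.app_AA hs h₁ h₂, fun _ => nofun, fun _ _ => ⟨nofun, nofun⟩⟩
    · obtain ⟨hq, -, hne⟩ := ih h'
      exact ⟨.app_cf hq (hne h₁ h₂).1 (hne h₁ h₂).2, fun _ => nofun, fun _ _ => ⟨nofun, nofun⟩⟩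
    · exact absurd h' h₁
  | app_AA hs h₁ h₂ ih =>
    rcases h.app_cases with ⟨s', h', rfl⟩ | ⟨t', h', rfl⟩ | ⟨_, _, ⟨⟩, _⟩ | ⟨⟨⟩, _⟩ | ⟨_, ⟨⟩, h'⟩
    · exact (not_stepCA_arr_base_tyA h').elim
    · obtain ⟨hq, -, hne⟩ := ih h'
      exact ⟨.app_AA hq (hne h₁ h₂).1 (hne h₁ h₂).2, fun _ => nofun, fun _ _ => ⟨nofun, nofun⟩⟩
    · exact absurd h' h₂
  | app_lam T m hs hn ih =>
    rcases h.app_cases with ⟨s', h', rfl⟩ | ⟨t', h', rfl⟩ | ⟨_, _, _, hv⟩ | ⟨⟨⟩, _⟩ | ⟨_, ⟨⟩, _⟩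
    · refine ⟨?_, fun _ => nofun, fun _ _ => ⟨nofun, nofun⟩⟩
      obtain ⟨m', rfl | rfl⟩ := h'.exists_of_lam
      · exact .app_lam T m' hs hn
      · exact .app_arr T m' hs hn
    · obtain ⟨hq, hv, -⟩ := ih h'
      exact ⟨.app_lam T m hq (hv hn), fun _ => nofun, fun _ _ => ⟨nofun, nofun⟩⟩
    · exact absurd hv hn
  | app_arr T m hs hn ih =>
    rcases h.app_cases with ⟨s', h', rfl⟩ | ⟨t', h', rfl⟩ | ⟨_, _, ⟨⟩, _⟩ | ⟨⟨⟩, _⟩ | ⟨_, _, rfl⟩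
    · obtain ⟨m', rfl⟩ := h'.exists_of_arr
      exact ⟨.app_arr T m' hs hn, fun _ => nofun, fun _ _ => ⟨nofun, nofun⟩⟩
    · obtain ⟨hq, hv, -⟩ := ih h'
      exact ⟨.app_arr T m hq (hv hn), fun _ => nofun, fun _ _ => ⟨nofun, nofun⟩⟩
    · exact absurd (isValue_ofTy_s12 _) hn
  | app_app hs ht hn ihs iht =>
    rcases h.app_cases with ⟨s', h', rfl⟩ | ⟨t', h', rfl⟩ | ⟨_, _, rfl, _⟩ | ⟨rfl, _⟩ | ⟨_, rfl, _⟩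
    · obtain ⟨hq, hv, -⟩ := ihs h'
      exact ⟨.app_app hq ht (hv hn), fun _ => nofun, fun _ _ => ⟨nofun, nofun⟩⟩
    · exact ⟨.app_app hs (iht h').1 hn, fun _ => nofun, fun _ _ => ⟨nofun, nofun⟩⟩
    · exact absurd (.lam _ _) hn
    · exact absurd .cf hn
    · exact absurd (.arr _ _) hn

end MTm

/-- A closed quasi-stuck term that `→ca`-reduces to a type is a mixed value. -/
theorem closed_quasi_stuck_typable_is_value (m : MTm) (T : MTy)
    (hclosed : ClosedUnder 0 m) (hqs : QuasiStuck m)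
    (h : ReflTransGen (fun x y => StepC x y ∨ StepA x y) m (ofTy T)) :
    IsValue m := by
  by_contra hn
  have key : ∀ r, ReflTransGen (fun x y => StepC x y ∨ StepA x y) m r →
      QuasiStuck r ∧ ¬ IsValue r := by
    intro r hr
    induction hr with
    | refl => exact ⟨hqs, hn⟩
    | tail _ hstep ih =>
      obtain ⟨hq, hv, -⟩ := ih.1.stepCA hstep
      exact ⟨hq, hv ih.2⟩
  exact (key _ h).2 (isValue_ofTy_s12 T)
end

section
/- (Progress) If a standard term t is closed, t →a* T for some type T, and t is a normal form with respect to call-by-value reduction →c, then t is a standard value. -/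
open Relation MTm

namespace MTm

/-- Inversion for typable applications: the function reduces to an arrow type
whose domain is a type of the argument. -/
lemma exists_arrow_of_app {m₁ m₂ : MTm} {T : MTy}
    (h : ReflTransGen StepA (app m₁ m₂) (ofTy T)) :
    ∃ S, ReflTransGen StepA m₁ (ofTy (.arrow S T)) ∧ ReflTransGen StepA m₂ (ofTy S) := by
  generalize hm : app m₁ m₂ = m at h
  induction h using ReflTransGen.head_induction_on generalizing m₁ m₂ with
  | refl => cases T <;> simp [ofTy] at hm
  | head hstep hrest ih =>
    subst hm
    cases hstep with
    | beta S => exact ⟨S, hrest.lift (arr S) fun _ _ => StepA.arrC S, .refl⟩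
    | appL _ h₁ =>
      obtain ⟨S, hf, ha⟩ := ih rfl
      exact ⟨S, hf.head h₁, ha⟩
    | appR _ h₂ =>
      obtain ⟨S, hf, ha⟩ := ih rfl
      exact ⟨S, hf, ha.head h₂⟩

/-- A property preserved by abstract reduction holds of every reduct. -/
lemma invariant_of_reduces {P : MTm → Prop} (hP : ∀ m m', P m → StepA m m' → P m')
    {m m' : MTm} (h : ReflTransGen StepA m m') (hm : P m) : P m' := by
  induction h with
  | refl => exact hm
  | tail _ hstep ih => exact hP _ _ ih hstep

lemma eq_of_ca_reduces {m : MTm} (h : ReflTransGen StepA ca m) : m = ca ∨ m = tyA := by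
  refine invariant_of_reduces (P := fun m => m = ca ∨ m = tyA) ?_ h (.inl rfl)
  rintro m m' (rfl | rfl) hstep <;> cases hstep
  exact .inr rfl

lemma eq_of_cf_reduces {m : MTm} (h : ReflTransGen StepA cf m) :
    m = cf ∨ m = arr .base tyA := by
  refine invariant_of_reduces (P := fun m => m = cf ∨ m = arr .base tyA) ?_ h (.inl rfl)
  rintro m m' (rfl | rfl) hstep <;> cases hstep
  · exact .inr rfl
  · rename_i h
    cases h

lemma not_lam_reduces_tyA {T : MTy} {m : MTm} : ¬ ReflTransGen StepA (lam T m) tyA := by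
  intro h
  have key := invariant_of_reduces
    (P := fun m => (∃ T t, m = lam T t) ∨ ∃ T t, m = arr T t) ?_ h (.inl ⟨T, m, rfl⟩)
  · simp at key
  · rintro m m' (⟨T, t, rfl⟩ | ⟨T, t, rfl⟩) hstep <;> cases hstep <;> simp

lemma IsStdValue.isValue {v : MTm} (h : IsStdValue v) : IsValue v := by
  cases h <;> constructor

/-- The only standard value of base type is the constant `a`. -/
lemma IsStdValue.eq_ca_of_reduces_tyA {v : MTm} (hv : IsStdValue v)
    (h : ReflTransGen StepA v tyA) : v = MTm.ca := by
  cases hv with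
  | lam => exact absurd h not_lam_reduces_tyA
  | ca => rfl
  | cf => simpa using eq_of_cf_reduces h

/-- A standard value of arrow type applied to a standard value of its domain
is a call-by-value redex. -/
lemma IsStdValue.exists_stepC_app {v w : MTm} {S T : MTy} (hv : IsStdValue v)
    (hw : IsStdValue w) (hvT : ReflTransGen StepA v (ofTy (.arrow S T)))
    (hwS : ReflTransGen StepA w (ofTy S)) : ∃ u, StepC (app v w) u := by
  cases hv with
  | lam => exact ⟨_, .beta _ _ hw.isValue⟩
  | ca => simpa [ofTy] using eq_of_ca_reduces hvT
  | cf =>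
    have hS : S = .base := by
      have := eq_of_cf_reduces hvT
      simp only [ofTy, reduceCtorEq, false_or, arr.injEq] at this
      exact this.1
    subst hS
    rw [hw.eq_ca_of_reduces_tyA hwS]
    exact ⟨_, .fa⟩

end MTm

/-- Progress: a closed, typable standard term in `→c`-normal form is a
standard value. -/
theorem progress (t : MTm) (T : MTy)
    (hstd : IsStandard t) (hclosed : ClosedUnder 0 t)
    (htyp : ReflTransGen StepA t (ofTy T))
    (hnf : ∀ u, ¬ StepC t u) : IsStdValue t := by
  induction hstd generalizing T with
  | var x => exact absurd hclosed (Nat.not_lt_zero x)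
  | lam _ ht => exact .lam _ ht
  | ca => exact .ca
  | cf => exact .cf
  | app _ _ ih₁ ih₂ =>
    obtain ⟨S, hf, ha⟩ := exists_arrow_of_app htyp
    have hv := ih₁ _ hclosed.1 hf fun u hu => hnf _ (.appL _ hu)
    have hw := ih₂ _ hclosed.2 ha fun u hu => hnf _ (.appR hv.isValue hu)
    obtain ⟨u, hu⟩ := hv.exists_stepC_app hw hf ha
    exact absurd hu (hnf u)
end

section
/- (Abstraction Theorem) For all mixed terms m, m' of pure STLC and every assignment φ whose domain contains the free variables of m: if m →a m', then ⟦m⟧_φ ⊆ ⟦m'⟧_φ. -/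
/-- Simple types over a set `B` of base type constants. -/
inductive PTy (B : Type) : Type
  | base : B → PTy B
  | arrow : PTy B → PTy B → PTy B

/-- Mixed terms of pure STLC (de Bruijn indices):
`m ::= x | λx:T.m | m m' | A | T ⇒ m`. -/
inductive PTm (B : Type) : Type
  | var : ℕ → PTm B
  | lam : PTy B → PTm B → PTm B
  | app : PTm B → PTm B → PTm B
  | tybase : B → PTm B          -- a base type constant as a mixed term
  | arr : PTy B → PTm B → PTm B -- `T ⇒ m`

namespace PTm

variable {B : Type}

/-- The embedding of types into mixed terms. -/
def ofTy : PTy B → PTm B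
  | .base b => tybase b
  | .arrow T1 T2 => arr T1 (ofTy T2)

/-- de Bruijn shifting of indices `≥ c` by `d`. -/
def shift (d c : ℕ) : PTm B → PTm B
  | var k => if k < c then var k else var (k + d)
  | lam T m => lam T (shift d (c + 1) m)
  | app m1 m2 => app (shift d c m1) (shift d c m2)
  | tybase b => tybase b
  | arr T m => arr T (shift d c m)

/-- Capture-avoiding substitution `[s / j] m` (de Bruijn). -/
def subst (j : ℕ) (s : PTm B) : PTm B → PTm B
  | var k => if k = j then s else if j < k then var (k - 1) else var k
  | lam T m => lam T (subst (j + 1) (shift 1 0 s) m)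
  | app m1 m2 => app (subst j s m1) (subst j s m2)
  | tybase b => tybase b
  | arr T m => arr T (subst j s m)

/-- Concrete β-reduction `→b`, closed under arbitrary contexts. -/
inductive StepB : PTm B → PTm B → Prop
  | beta (T m m') : StepB (app (lam T m) m') (subst 0 m' m)
  | lamC {m m'} (T) : StepB m m' → StepB (lam T m) (lam T m')
  | appL {m1 m1'} (m2) : StepB m1 m1' → StepB (app m1 m2) (app m1' m2)
  | appR {m2 m2'} (m1) : StepB m2 m2' → StepB (app m1 m2) (app m1 m2')
  | arrC {m m'} (T) : StepB m m' → StepB (arr T m) (arr T m')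

/-- Abstract reduction `→a`, closed under arbitrary contexts. -/
inductive StepA : PTm B → PTm B → Prop
  | beta (T m) : StepA (app (arr T m) (ofTy T)) m
  | lamAbs (T m) : StepA (lam T m) (arr T (subst 0 (ofTy T) m))
  | lamC {m m'} (T) : StepA m m' → StepA (lam T m) (lam T m')
  | appL {m1 m1'} (m2) : StepA m1 m1' → StepA (app m1 m2) (app m1' m2)
  | appR {m2 m2'} (m1) : StepA m2 m2' → StepA (app m1 m2) (app m1 m2')
  | arrC {m m'} (T) : StepA m m' → StepA (arr T m) (arr T m')

/-- Standard terms: `t ::= x | λx:T.t | t t'`. -/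
inductive IsStandard : PTm B → Prop
  | var (x) : IsStandard (var x)
  | lam (T) {t} : IsStandard t → IsStandard (lam T t)
  | app {t1 t2} : IsStandard t1 → IsStandard t2 → IsStandard (app t1 t2)

/-- All free de Bruijn indices are `< n`. -/
def ClosedUnder : ℕ → PTm B → Prop
  | n, var k => k < n
  | n, lam _ m => ClosedUnder (n + 1) m
  | n, app m1 m2 => ClosedUnder n m1 ∧ ClosedUnder n m2
  | _, tybase _ => True
  | n, arr _ m => ClosedUnder n m

/-- `WN`: the set of standard terms that are weakly normalizing for `→b`. -/
def WNset : Set (PTm B) :=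
  { t | IsStandard t ∧ ∃ t', Relation.ReflTransGen StepB t t' ∧ ∀ u, ¬ StepB t' u }

/-- Closure of a set of terms under `→b*`-predecessors (among standard terms). -/
def predCl (R : Set (PTm B)) : Set (PTm B) :=
  { t | IsStandard t ∧ ∃ t' ∈ R, Relation.ReflTransGen StepB t t' }

/-- The interpretation of types as sets of standard terms. -/
def tyInterp : PTy B → Set (PTm B)
  | .base _ => WNset
  | .arrow T1 T2 => { t | ∀ t' ∈ tyInterp T1, app t t' ∈ tyInterp T2 }

/-- Extending an assignment with a set for the newly bound variable
(de Bruijn index 0). -/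
def consEnv (R : Set (PTm B)) (φ : ℕ → Set (PTm B)) : ℕ → Set (PTm B)
  | 0 => R
  | n + 1 => φ n

/-- The interpretation `⟦m⟧_φ` of a mixed term as a set of standard terms. -/
def interp : PTm B → (ℕ → Set (PTm B)) → Set (PTm B)
  | var x, φ => φ x
  | tybase _, _ => WNset
  | arr T m, φ => { t | ∀ t' ∈ tyInterp T, app t t' ∈ interp m φ }
  | lam T m, φ => predCl { s | ∃ t, s = lam T t ∧ IsStandard t ∧
      ∀ t' ∈ tyInterp T, subst 0 t' t ∈ interp m (consEnv (tyInterp T) φ) }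
  | app m1 m2, φ => predCl { s | ∃ t1 t2, s = app t1 t2 ∧
      t1 ∈ interp m1 φ ∧ t2 ∈ interp m2 φ }

/-- Reducibility sets: nonempty sets of standard, weakly normalizing terms,
closed under `→b*`-predecessors. -/
def ReducibilitySet (R : Set (PTm B)) : Prop :=
  (∀ t ∈ R, IsStandard t) ∧
  (∀ t' t : PTm B, IsStandard t' → Relation.ReflTransGen StepB t' t → t ∈ R → t' ∈ R) ∧
  R.Nonempty ∧ R ⊆ WNset

end PTm

open Relation PTm

namespace PTm

variable {B : Type}

theorem shift_ofTy (d c : ℕ) (T : PTy B) : shift d c (ofTy T) = ofTy T := by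
  induction T with
  | base b => rfl
  | arrow T1 T2 _ ih => simp [ofTy, shift, ih]

theorem interp_ofTy (T : PTy B) (φ : ℕ → Set (PTm B)) : interp (ofTy T) φ = tyInterp T := by
  induction T with
  | base b => rfl
  | arrow T1 T2 _ ih => simp [ofTy, interp, tyInterp, ih]

theorem subst_shift_one (m s : PTm B) (j : ℕ) : subst j s (shift 1 j m) = m := by
  induction m generalizing j s with
  | var k =>
    simp only [shift]
    split_ifs with h
    · simp [subst, h.ne, h.not_gt]
    · have h1 : k + 1 ≠ j := by omega
      have h2 : j < k + 1 := by omega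
      simp [subst, h1, h2]
  | lam T m ih => simp [shift, subst, ih]
  | app m1 m2 ih1 ih2 => simp [shift, subst, ih1, ih2]
  | tybase b => rfl
  | arr T m ih => simp [shift, subst, ih]

theorem IsStandard.shift {m : PTm B} (h : IsStandard m) (d c : ℕ) :
    IsStandard (shift d c m) := by
  induction h generalizing c with
  | var x => simp only [PTm.shift]; split_ifs <;> exact .var _
  | lam T _ ih => exact .lam T (ih _)
  | app _ _ ih1 ih2 => exact .app (ih1 _) (ih2 _)

theorem reflTransGen_appL {t t' : PTm B} (u : PTm B) (h : ReflTransGen StepB t t') :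
    ReflTransGen StepB (app t u) (app t' u) :=
  h.lift (fun x => app x u) fun _ _ => StepB.appL u

/-- Closure under standard `→b*`-predecessors. -/
def PredClosed (R : Set (PTm B)) : Prop :=
  ∀ t' t : PTm B, IsStandard t' → ReflTransGen StepB t' t → t ∈ R → t' ∈ R

theorem predClosed_WNset : PredClosed (WNset : Set (PTm B)) :=
  fun _ _ hs hr ⟨_, u, hu, hn⟩ => ⟨hs, u, hr.trans hu, hn⟩

theorem predClosed_predCl (R : Set (PTm B)) : PredClosed (predCl R) :=
  fun _ _ hs hr ⟨_, u, hu, hn⟩ => ⟨hs, u, hu, hr.trans hn⟩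

theorem predCl_mono {R S : Set (PTm B)} (h : R ⊆ S) : predCl R ⊆ predCl S :=
  fun _ ⟨hs, u, hu, hr⟩ => ⟨hs, u, h hu, hr⟩

theorem tyInterp_spec (T : PTy B) :
    (∀ t ∈ tyInterp T, IsStandard t) ∧ PredClosed (tyInterp T) ∧ (tyInterp T).Nonempty := by
  induction T with
  | base b =>
    exact ⟨fun t h => h.1, predClosed_WNset, var 0, .var 0, var 0, .refl, fun _ hu => nomatch hu⟩
  | arrow T1 T2 ih1 ih2 =>
    obtain ⟨s1, -, a, ha⟩ := ih1
    obtain ⟨s2, c2, b, hb⟩ := ih2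
    refine ⟨fun t ht => ?_, fun t' t hs hr ht u hu => ?_, lam T1 (shift 1 0 b), fun u hu => ?_⟩
    · cases s2 _ (ht a ha) with
      | app h _ => exact h
    · exact c2 _ _ (.app hs (s1 u hu)) (reflTransGen_appL u hr) (ht u hu)
    · refine c2 _ b (.app (.lam T1 ((s2 b hb).shift 1 0)) (s1 u hu)) (.single ?_) hb
      simpa only [subst_shift_one] using StepB.beta T1 (shift 1 0 b) u

theorem isStandard_of_mem_tyInterp {T : PTy B} {t : PTm B} (h : t ∈ tyInterp T) : IsStandard t :=
  (tyInterp_spec T).1 t h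

theorem predClosed_consEnv (T : PTy B) {φ : ℕ → Set (PTm B)} (hφ : ∀ x, PredClosed (φ x)) :
    ∀ x, PredClosed (consEnv (tyInterp T) φ x)
  | 0 => (tyInterp_spec T).2.1
  | x + 1 => hφ x

theorem predClosed_interp (m : PTm B) {φ : ℕ → Set (PTm B)} (hφ : ∀ x, PredClosed (φ x)) :
    PredClosed (interp m φ) := by
  induction m with
  | var k => exact hφ k
  | lam T m _ => exact predClosed_predCl _
  | app m1 m2 _ _ => exact predClosed_predCl _
  | tybase b => exact predClosed_WNset
  | arr T m ih =>
    exact fun t' t hs hr ht u hu =>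
      ih _ _ (.app hs (isStandard_of_mem_tyInterp hu)) (reflTransGen_appL u hr) (ht u hu)

/-- Inserting a set at position `j` of an assignment. -/
def insertEnv (j : ℕ) (R : Set (PTm B)) (φ : ℕ → Set (PTm B)) : ℕ → Set (PTm B) :=
  fun k => if k = j then R else if j < k then φ (k - 1) else φ k

theorem insertEnv_zero (R : Set (PTm B)) (φ : ℕ → Set (PTm B)) :
    insertEnv 0 R φ = consEnv R φ := by
  funext k
  cases k <;> simp [insertEnv, consEnv]

theorem consEnv_insertEnv (j : ℕ) (R S : Set (PTm B)) (φ : ℕ → Set (PTm B)) :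
    consEnv S (insertEnv j R φ) = insertEnv (j + 1) R (consEnv S φ) := by
  funext k
  rcases k with _ | _ | k <;> simp [insertEnv, consEnv, eq_comm]

theorem interp_subst_ofTy (T : PTy B) (m : PTm B) (j : ℕ) (φ : ℕ → Set (PTm B)) :
    interp (subst j (ofTy T) m) φ = interp m (insertEnv j (tyInterp T) φ) := by
  induction m generalizing j φ with
  | var k =>
    simp only [subst, interp, insertEnv]
    split_ifs
    · exact interp_ofTy T φ
    · rfl
    · rfl
  | lam S m ih => simp only [subst, interp, shift_ofTy, ih, consEnv_insertEnv]
  | app m1 m2 ih1 ih2 => simp only [subst, interp, ih1, ih2]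
  | tybase b => rfl
  | arr S m ih => simp only [subst, interp, ih]

theorem StepA.interp_subset {m m' : PTm B} (h : StepA m m') {φ : ℕ → Set (PTm B)}
    (hφ : ∀ x, PredClosed (φ x)) : interp m φ ⊆ interp m' φ := by
  induction h generalizing φ with
  | beta T m =>
    rintro s ⟨hs, _, ⟨t1, t2, rfl, h1, h2⟩, hr⟩
    rw [interp_ofTy] at h2
    exact predClosed_interp m hφ _ _ hs hr (h1 t2 h2)
  | lamAbs T m =>
    rintro s ⟨hs, _, ⟨t, rfl, _, ht⟩, hr⟩ u hu
    rw [interp_subst_ofTy, insertEnv_zero]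
    exact predClosed_interp m (predClosed_consEnv T hφ) _ _
      (.app hs (isStandard_of_mem_tyInterp hu))
      ((reflTransGen_appL u hr).tail (.beta T t u)) (ht u hu)
  | lamC T _ ih =>
    exact predCl_mono fun _ ⟨t, e, ht, h⟩ =>
      ⟨t, e, ht, fun u hu => ih (predClosed_consEnv T hφ) (h u hu)⟩
  | appL m2 _ ih => exact predCl_mono fun _ ⟨t1, t2, e, h1, h2⟩ => ⟨t1, t2, e, ih hφ h1, h2⟩
  | appR m1 _ ih => exact predCl_mono fun _ ⟨t1, t2, e, h1, h2⟩ => ⟨t1, t2, e, h1, ih hφ h2⟩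
  | arrC T _ ih => exact fun t ht u hu => ih hφ (ht u hu)

end PTm

/-- Abstraction Theorem: interpretation is monotonic with respect to
abstract reduction. -/
theorem abstraction_theorem {B : Type} [Nonempty B] (m m' : PTm B)
    (φ : ℕ → Set (PTm B)) (hφ : ∀ x, ReducibilitySet (φ x))
    (h : StepA m m') : interp m φ ⊆ interp m' φ := by
  exact h.interp_subset fun x => (hφ x).2.1
end

section
/- (Normalization for Typable Terms) For every closed standard term t of pure STLC and every type T: if t →a* T, then t is weakly normalizing with respect to →b (i.e. t ∈ WN). -/
open Relation PTm

namespace PTm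

variable {B : Type}

/-- Prepend a value to a stream indexed by de Bruijn indices. -/
def scons {α : Type} (a : α) (f : ℕ → α) : ℕ → α
  | 0 => a
  | n + 1 => f n

/-- Lifting of a renaming under a binder. -/
def upRen (ρ : ℕ → ℕ) : ℕ → ℕ := scons 0 fun n => ρ n + 1

/-- Simultaneous renaming. -/
def ren (ρ : ℕ → ℕ) : PTm B → PTm B
  | var k => var (ρ k)
  | lam T m => lam T (ren (upRen ρ) m)
  | app m n => app (ren ρ m) (ren ρ n)
  | tybase b => tybase b
  | arr T m => arr T (ren ρ m)

/-- Lifting of a substitution under a binder. -/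
def upSub (σ : ℕ → PTm B) : ℕ → PTm B := scons (var 0) fun n => ren Nat.succ (σ n)

/-- Simultaneous substitution. -/
def sub (σ : ℕ → PTm B) : PTm B → PTm B
  | var k => σ k
  | lam T m => lam T (sub (upSub σ) m)
  | app m n => app (sub σ m) (sub σ n)
  | tybase b => tybase b
  | arr T m => arr T (sub σ m)

theorem upRen_comp (ρ τ : ℕ → ℕ) : upRen ρ ∘ upRen τ = upRen (ρ ∘ τ) := by
  funext k; cases k <;> rfl

theorem ren_ren (ρ τ : ℕ → ℕ) (m : PTm B) : ren ρ (ren τ m) = ren (ρ ∘ τ) m := by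
  induction m generalizing ρ τ <;> simp_all [ren, upRen_comp]

theorem upSub_comp_upRen (σ : ℕ → PTm B) (ρ : ℕ → ℕ) :
    upSub σ ∘ upRen ρ = upSub (σ ∘ ρ) := by
  funext k; cases k <;> rfl

theorem sub_ren (σ : ℕ → PTm B) (ρ : ℕ → ℕ) (m : PTm B) :
    sub σ (ren ρ m) = sub (σ ∘ ρ) m := by
  induction m generalizing σ ρ <;> simp_all [ren, sub, upSub_comp_upRen]

theorem ren_upRen_comp_upSub (ρ : ℕ → ℕ) (σ : ℕ → PTm B) :
    ren (upRen ρ) ∘ upSub σ = upSub (ren ρ ∘ σ) := by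
  funext k
  cases k with
  | zero => rfl
  | succ k =>
    change ren (upRen ρ) (ren Nat.succ (σ k)) = ren Nat.succ (ren ρ (σ k))
    rw [ren_ren, ren_ren]
    rfl

theorem ren_sub (ρ : ℕ → ℕ) (σ : ℕ → PTm B) (m : PTm B) :
    ren ρ (sub σ m) = sub (ren ρ ∘ σ) m := by
  induction m generalizing σ ρ <;> simp_all [ren, sub, ren_upRen_comp_upSub]

theorem sub_upSub_comp_upSub (σ τ : ℕ → PTm B) :
    sub (upSub σ) ∘ upSub τ = upSub (sub σ ∘ τ) := by
  funext k
  cases k with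
  | zero => rfl
  | succ k =>
    change sub (upSub σ) (ren Nat.succ (τ k)) = ren Nat.succ (sub σ (τ k))
    rw [sub_ren, ren_sub]
    rfl

theorem sub_sub (σ τ : ℕ → PTm B) (m : PTm B) :
    sub σ (sub τ m) = sub (sub σ ∘ τ) m := by
  induction m generalizing σ τ <;> simp_all [sub, sub_upSub_comp_upSub]

theorem upSub_var : upSub (var : ℕ → PTm B) = var := by
  funext k; cases k <;> rfl

theorem sub_var (m : PTm B) : sub var m = m := by
  induction m <;> simp_all [sub, upSub_var]

theorem upRen_id : upRen id = id := by
  funext k; cases k <;> rfl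

theorem ren_id (m : PTm B) : ren id m = m := by
  induction m <;> simp_all [ren, upRen_id]

theorem shift_one_eq_ren (c : ℕ) (m : PTm B) :
    shift 1 c m = ren (fun k => if k < c then k else k + 1) m := by
  induction m generalizing c with
  | lam T m ih =>
    simp only [shift, ren, ih]
    congr 2
    funext k
    cases k with
    | zero => simp [upRen, scons]
    | succ k => by_cases h : k < c <;> simp [upRen, scons, h]
  | var k => by_cases h : k < c <;> simp [shift, ren, h]
  | _ => simp_all [shift, ren]

theorem shift_one_zero_eq_ren (m : PTm B) : shift 1 0 m = ren Nat.succ m := by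
  rw [shift_one_eq_ren]
  rfl

theorem subst_eq_sub (j : ℕ) (s m : PTm B) :
    subst j s m = sub (fun k => if k = j then s else if j < k then var (k - 1) else var k) m := by
  induction m generalizing j s with
  | lam T m ih =>
    simp only [subst, sub, ih, shift_one_zero_eq_ren]
    congr 2
    funext k
    rcases k with _ | k
    · simp [upSub, scons]
    · rcases lt_trichotomy k j with h | h | h
      · simp [upSub, scons, h.ne, h.not_gt, ren]
      · simp [upSub, scons, h]
      · simp [upSub, scons, h.ne', h, ren]
        omega
  | _ => simp_all [subst, sub]

theorem subst_zero_eq_sub (s m : PTm B) : subst 0 s m = sub (scons s var) m := by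
  rw [subst_eq_sub]
  congr 1
  funext k
  cases k <;> simp [scons]

theorem subst_zero_sub_upSub (s : PTm B) (σ : ℕ → PTm B) (m : PTm B) :
    subst 0 s (sub (upSub σ) m) = sub (scons s σ) m := by
  rw [subst_zero_eq_sub, sub_sub]
  congr 1
  funext k
  cases k with
  | zero => rfl
  | succ k =>
    change sub (scons s var) (ren Nat.succ (σ k)) = σ k
    rw [sub_ren]
    exact sub_var _

theorem ren_subst_zero (ρ : ℕ → ℕ) (s m : PTm B) :
    ren ρ (subst 0 s m) = subst 0 (ren ρ s) (ren (upRen ρ) m) := by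
  rw [subst_zero_eq_sub, subst_zero_eq_sub, ren_sub, sub_ren]
  congr 1
  funext k
  cases k <;> rfl

theorem StepB.ren {m n : PTm B} (h : StepB m n) (ρ : ℕ → ℕ) :
    StepB (PTm.ren ρ m) (PTm.ren ρ n) := by
  induction h generalizing ρ with
  | beta T m m' => rw [ren_subst_zero]; exact .beta _ _ _
  | lamC T _ ih => exact .lamC _ (ih _)
  | appL m _ ih => exact .appL _ (ih _)
  | appR m _ ih => exact .appR _ (ih _)
  | arrC T _ ih => exact .arrC _ (ih _)

theorem reflTransGen_stepB_ren {m n : PTm B} (h : Relation.ReflTransGen StepB m n) (ρ : ℕ → ℕ) :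
    Relation.ReflTransGen StepB (ren ρ m) (ren ρ n) :=
  h.lift _ fun _ _ h => h.ren ρ

theorem reflTransGen_stepB_app {m m' n n' : PTm B} (hm : Relation.ReflTransGen StepB m m')
    (hn : Relation.ReflTransGen StepB n n') :
    Relation.ReflTransGen StepB (app m n) (app m' n') :=
  (hm.lift (fun x => app x n) fun _ _ h => .appL _ h).trans
    (hn.lift (app m') fun _ _ h => .appR _ h)

/-- Syntactic β-normal forms; `NormalForm true` holds of the neutral ones only. -/
inductive NormalForm : Bool → PTm B → Prop
  | var (b k) : NormalForm b (var k)
  | app (b) {m n} : NormalForm true m → NormalForm false n → NormalForm b (app m n)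
  | lam (T) {m} : NormalForm false m → NormalForm false (lam T m)

theorem NormalForm.of_neutral {m : PTm B} (h : NormalForm true m) : NormalForm false m := by
  cases h with
  | var => exact .var _ _
  | app _ h₁ h₂ => exact .app _ h₁ h₂

theorem NormalForm.ren {b : Bool} {m : PTm B} (h : NormalForm b m) (ρ : ℕ → ℕ) :
    NormalForm b (PTm.ren ρ m) := by
  induction h generalizing ρ with
  | var => exact .var _ _
  | app _ _ _ ih₁ ih₂ => exact .app _ (ih₁ _) (ih₂ _)
  | lam T _ ih => exact .lam _ (ih _)

theorem NormalForm.not_stepB {b : Bool} {m : PTm B} (h : NormalForm b m) (u : PTm B) :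
    ¬ StepB m u := by
  induction h generalizing u with
  | var => intro hs; cases hs
  | app _ h₁ _ ih₁ ih₂ =>
    intro hs
    cases hs with
    | beta => cases h₁
    | appL _ hs => exact ih₁ _ hs
    | appR _ hs => exact ih₂ _ hs
  | lam T _ ih =>
    intro hs
    cases hs with
    | lamC _ hs => exact ih _ hs

/-- Reduction to a normal form, neutral if `b = true`. -/
def HasNormalForm (b : Bool) (m : PTm B) : Prop :=
  ∃ n, Relation.ReflTransGen StepB m n ∧ NormalForm b n

theorem HasNormalForm.ren {b : Bool} {m : PTm B} (h : HasNormalForm b m) (ρ : ℕ → ℕ) :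
    HasNormalForm b (PTm.ren ρ m) :=
  let ⟨n, hr, hn⟩ := h
  ⟨PTm.ren ρ n, reflTransGen_stepB_ren hr ρ, hn.ren ρ⟩

/-- The Kripke-style reducibility predicate. -/
def Reducible : PTy B → PTm B → Prop
  | .base _, m => HasNormalForm false m
  | .arrow T U, m => HasNormalForm false m ∧
      ∀ (ρ : ℕ → ℕ) (s : PTm B), Reducible T s → Reducible U (app (ren ρ m) s)

theorem Reducible.hasNormalForm {T : PTy B} {m : PTm B} (h : Reducible T m) :
    HasNormalForm false m := by
  cases T with
  | base => exact h
  | arrow => exact h.1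

theorem Reducible.of_reflTransGen {T : PTy B} {m n : PTm B}
    (hr : Relation.ReflTransGen StepB m n) (h : Reducible T n) : Reducible T m := by
  have hnf : HasNormalForm false m :=
    let ⟨k, hk, hn⟩ := h.hasNormalForm
    ⟨k, hr.trans hk, hn⟩
  induction T generalizing m n with
  | base => exact hnf
  | arrow T U _ ih =>
    refine ⟨hnf, fun ρ s hs => ?_⟩
    have hr' := reflTransGen_stepB_app (reflTransGen_stepB_ren hr ρ) (.refl (a := s))
    have h' := h.2 ρ s hs
    obtain ⟨k, hk, hn⟩ := h'.hasNormalForm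
    exact ih hr' h' ⟨k, hr'.trans hk, hn⟩

theorem Reducible.of_neutral {T : PTy B} {m : PTm B} (h : HasNormalForm true m) :
    Reducible T m := by
  have hnf : HasNormalForm false m :=
    let ⟨n, hr, hn⟩ := h
    ⟨n, hr, hn.of_neutral⟩
  induction T generalizing m with
  | base => exact hnf
  | arrow T U _ ih =>
    refine ⟨hnf, fun ρ s hs => ?_⟩
    obtain ⟨n, hr, hn⟩ := h.ren ρ
    obtain ⟨k, hk, hkn⟩ := hs.hasNormalForm
    exact ih ⟨_, reflTransGen_stepB_app hr hk, .app _ hn hkn⟩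
      ⟨_, reflTransGen_stepB_app hr hk, .app _ hn hkn⟩

theorem Reducible.var (T : PTy B) (k : ℕ) : Reducible T (PTm.var k) :=
  .of_neutral ⟨_, .refl, .var _ _⟩

theorem Reducible.ren {T : PTy B} {m : PTm B} (h : Reducible T m) (ρ : ℕ → ℕ) :
    Reducible T (PTm.ren ρ m) := by
  cases T with
  | base => exact HasNormalForm.ren h ρ
  | arrow T U =>
    refine ⟨h.1.ren ρ, fun τ s hs => ?_⟩
    rw [ren_ren]
    exact h.2 _ s hs

/-- Simple typing of mixed terms; a type, seen as a mixed term, has itself as its type. -/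
inductive HasTy : (ℕ → PTy B) → PTm B → PTy B → Prop
  | var (Γ k) : HasTy Γ (var k) (Γ k)
  | lam {Γ m U} (T) : HasTy (scons T Γ) m U → HasTy Γ (lam T m) (.arrow T U)
  | app {Γ m n T U} : HasTy Γ m (.arrow T U) → HasTy Γ n T → HasTy Γ (app m n) U
  | tybase (Γ b) : HasTy Γ (tybase b) (.base b)
  | arr {Γ m U} (T) : HasTy Γ m U → HasTy Γ (arr T m) (.arrow T U)

theorem HasTy.ofTy (Γ : ℕ → PTy B) (T : PTy B) : HasTy Γ (ofTy T) T := by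
  induction T with
  | base b => exact .tybase _ _
  | arrow T U _ ih => exact .arr _ ih

theorem HasTy.eq_of_ofTy {Γ : ℕ → PTy B} {T U : PTy B} (h : HasTy Γ (PTm.ofTy T) U) : T = U := by
  induction T generalizing U with
  | base b => cases h; rfl
  | arrow T T' _ ih =>
    cases h with
    | arr _ h => rw [ih h]

theorem HasTy.of_ren {Δ : ℕ → PTy B} {ρ : ℕ → ℕ} {m : PTm B} {U : PTy B}
    (h : HasTy Δ (PTm.ren ρ m) U) : HasTy (Δ ∘ ρ) m U := by
  induction m generalizing Δ ρ U with
  | var k => cases h; exact .var (Δ ∘ ρ) k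
  | lam T m ih =>
    cases h with
    | lam _ h =>
      have e : scons T Δ ∘ upRen ρ = scons T (Δ ∘ ρ) := by funext k; cases k <;> rfl
      exact .lam _ (e ▸ ih h)
  | app m n ih₁ ih₂ =>
    cases h with
    | app h₁ h₂ => exact .app (ih₁ h₁) (ih₂ h₂)
  | tybase b => cases h; exact .tybase _ _
  | arr T m ih =>
    cases h with
    | arr _ h => exact .arr _ (ih h)

theorem HasTy.of_sub {Γ Δ : ℕ → PTy B} {σ : ℕ → PTm B} {m : PTm B} {U : PTy B}
    (hσ : ∀ k V, HasTy Δ (σ k) V → Γ k = V) (h : HasTy Δ (sub σ m) U) : HasTy Γ m U := by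
  induction m generalizing Γ Δ σ U with
  | var k => exact hσ k U h ▸ .var Γ k
  | lam T m ih =>
    cases h with
    | lam _ h =>
      refine .lam _ (ih (fun k V hk => ?_) h)
      cases k with
      | zero => cases hk; rfl
      | succ k => exact hσ k V hk.of_ren
  | app m n ih₁ ih₂ =>
    cases h with
    | app h₁ h₂ => exact .app (ih₁ hσ h₁) (ih₂ hσ h₂)
  | tybase b => cases h; exact .tybase _ _
  | arr T m ih =>
    cases h with
    | arr _ h => exact .arr _ (ih hσ h)

/-- Subject expansion for abstract reduction. -/
theorem HasTy.of_stepA {Γ : ℕ → PTy B} {m n : PTm B} {U : PTy B} (hs : StepA m n)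
    (h : HasTy Γ n U) : HasTy Γ m U := by
  induction hs generalizing Γ U with
  | beta T m => exact .app (.arr _ h) (.ofTy _ _)
  | lamAbs T m =>
    cases h with
    | arr _ h =>
      rw [subst_zero_eq_sub] at h
      refine .lam _ (.of_sub (fun k V hk => ?_) h)
      cases k with
      | zero => exact hk.eq_of_ofTy
      | succ k => cases hk; rfl
  | lamC T _ ih =>
    cases h with
    | lam _ h => exact .lam _ (ih h)
  | appL _ _ ih =>
    cases h with
    | app h₁ h₂ => exact .app (ih h₁) h₂
  | appR _ _ ih =>
    cases h with
    | app h₁ h₂ => exact .app h₁ (ih h₂)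
  | arrC T _ ih =>
    cases h with
    | arr _ h => exact .arr _ (ih h)

/-- Fundamental theorem of the reducibility predicate. -/
theorem HasTy.reducible_sub {Γ : ℕ → PTy B} {m : PTm B} {U : PTy B} (h : HasTy Γ m U)
    (hm : IsStandard m) {σ : ℕ → PTm B} (hσ : ∀ k, Reducible (Γ k) (σ k)) :
    Reducible U (sub σ m) := by
  induction h generalizing σ with
  | var Γ k => exact hσ k
  | @lam Γ m U T _ ih =>
    cases hm with
    | lam _ hm =>
      constructor
      · have hup : ∀ k, Reducible (scons T Γ k) (upSub σ k) := by
          rintro (_ | k)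
          · exact .var _ _
          · exact (hσ k).ren _
        obtain ⟨n, hr, hn⟩ := (ih hm hup).hasNormalForm
        exact ⟨_, hr.lift (PTm.lam T) fun _ _ h => .lamC _ h, .lam _ hn⟩
      · intro ρ s hs
        have hcons : ∀ k, Reducible (scons T Γ k) (scons s (PTm.ren ρ ∘ σ) k) := by
          rintro (_ | k)
          · exact hs
          · exact (hσ k).ren _
        refine .of_reflTransGen (.single (.beta _ _ _)) ?_
        rw [ren_sub, ren_upRen_comp_upSub, subst_zero_sub_upSub]
        exact ih hm hcons
  | app _ _ ih₁ ih₂ =>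
    cases hm with
    | app hm₁ hm₂ =>
      have h := (ih₁ hm₁ hσ).2 id _ (ih₂ hm₂ hσ)
      rwa [ren_id] at h
  | tybase => cases hm
  | arr => cases hm

theorem HasTy.mem_wnset {Γ : ℕ → PTy B} {m : PTm B} {U : PTy B} (h : HasTy Γ m U)
    (hm : IsStandard m) : m ∈ WNset := by
  have hred := h.reducible_sub hm fun k => .var (Γ k) k
  rw [sub_var] at hred
  obtain ⟨n, hr, hn⟩ := hred.hasNormalForm
  exact ⟨hm, n, hr, hn.not_stepB⟩

end PTm

/-- Normalization for typable terms: every closed standard term that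
abstractly reduces to a type is weakly normalizing for `→b`. -/
theorem normalization_typable {B : Type} [Nonempty B] (t : PTm B) (T : PTy B)
    (hstd : IsStandard t) (hclosed : ClosedUnder 0 t)
    (htyp : ReflTransGen StepA t (ofTy T)) : t ∈ WNset := by
  have b : B := Classical.arbitrary B
  have h : HasTy (fun _ => .base b) t T := by
    clear hstd hclosed
    induction htyp using ReflTransGen.head_induction_on with
    | refl => exact .ofTy _ _
    | head hs _ ih => exact .of_stepA hs ih
  exact h.mem_wnset hstd
end
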